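/- For every positive integer n, the point s = −2n is a simple zero of Riemann's auxiliary function R; that is, R(−2n) = 0 and R'(−2n) ≠ 0, where R' denotes the complex derivative of R. -/

import Mathlib

open MeasureTheory

/-- The straight line of slope 1 crossing the real axis at `1/2`,
parametrized from upper right to lower left. -/
noncomputable def rline (u : ℝ) : ℂ :=
  1 / 2 - Complex.exp (Real.pi * Complex.I / 4) * (u : ℂ)

/-- Riemann's auxiliary function
`R(s) = ∫_{0↙1} x^{-s} e^{πix²}/(e^{πix} − e^{-πix}) dx`, written out as an
integral over the real parameter of the line `0↙1`. Here `z ^ (-s)` is the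
principal power `exp (−s Log z)`. -/
noncomputable def RiemannR (s : ℂ) : ℂ :=
  -Complex.exp (Real.pi * Complex.I / 4) *
    ∫ u : ℝ, (rline u) ^ (-s) *
      Complex.exp (Real.pi * Complex.I * (rline u) ^ 2) /
      (Complex.exp (Real.pi * Complex.I * rline u) -
        Complex.exp (-(Real.pi * Complex.I * rline u)))


lemma shift_line (F : ℂ → ℂ) (a b : ℝ) (hab : a ≤ b) (C : ℝ)
    (hc : ContinuousOn F {z | z.im ∈ Set.Icc a b})
    (hd : DifferentiableOn ℂ F {z | z.im ∈ Set.Ioo a b})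
    (hb : ∀ z : ℂ, z.im ∈ Set.Icc a b → ‖F z‖ ≤ C * Real.exp (-z.re ^ 2)) :
    (∫ x : ℝ, F (x + a * Complex.I)) = ∫ x : ℝ, F (x + b * Complex.I) := by
  have hInt : ∀ y ∈ Set.Icc a b, Integrable (fun x : ℝ => F (x + y * Complex.I)) := by
    intro y hy
    have h1 : Integrable (fun x : ℝ => C * Real.exp (-1 * x ^ 2)) :=
      (integrable_exp_neg_mul_sq one_pos).const_mul C
    refine h1.mono' ?_ ?_
    · refine Continuous.aestronglyMeasurable ?_
      refine hc.comp_continuous (by fun_prop) ?_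
      intro x; simpa using hy
    · refine Filter.Eventually.of_forall fun x => ?_
      have := hb (x + y * Complex.I) (by simpa using hy)
      simpa using this
  have hT : ∀ y ∈ Set.Icc a b, Filter.Tendsto (fun T : ℝ => ∫ x in (-T)..T, F (x + y * Complex.I))
      Filter.atTop (nhds (∫ x : ℝ, F (x + y * Complex.I))) := fun y hy =>
    intervalIntegral_tendsto_integral (hInt y hy) Filter.tendsto_neg_atTop_atBot Filter.tendsto_id
  have hv : ∀ g : ℝ → ℝ, (∀ T, g T ^ 2 = T ^ 2) →
      Filter.Tendsto (fun T : ℝ => Complex.I • ∫ y in a..b, F (g T + y * Complex.I))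
        Filter.atTop (nhds 0) := by
    intro g hg
    have h2 : Filter.Tendsto (fun T : ℝ => C * Real.exp (-T ^ 2) * |b - a|) Filter.atTop (nhds 0) := by
      have : Filter.Tendsto (fun T : ℝ => Real.exp (-T ^ 2)) Filter.atTop (nhds 0) :=
        Real.tendsto_exp_neg_atTop_nhds_zero.comp (Filter.tendsto_pow_atTop two_ne_zero)
      simpa using (this.const_mul C).mul_const |b - a|
    refine squeeze_zero_norm (fun T => ?_) h2
    rw [norm_smul, Complex.norm_I, one_mul]
    refine intervalIntegral.norm_integral_le_of_norm_le_const fun y hy => ?_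
    rw [Set.uIoc_of_le hab] at hy
    have := hb (g T + y * Complex.I) (by simpa using Set.Ioc_subset_Icc_self hy)
    simpa [hg] using this
  have hR : ∀ T : ℝ, (∫ x in (-T)..T, F (x + a * Complex.I)) =
      (∫ x in (-T)..T, F (x + b * Complex.I)) - Complex.I • (∫ y in a..b, F (T + y * Complex.I))
        + Complex.I • ∫ y in a..b, F ((-T : ℝ) + y * Complex.I) := by
    intro T
    have := Complex.integral_boundary_rect_eq_zero_of_continuousOn_of_differentiableOn F
      ⟨-T, a⟩ ⟨T, b⟩ (hc.mono ?_) (hd.mono ?_)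
    · simp only at this
      linear_combination this
    · intro z hz
      rw [Complex.mem_reProdIm] at hz
      simpa [Set.uIcc_of_le hab] using hz.2
    · intro z hz
      rw [Complex.mem_reProdIm] at hz
      simpa [hab] using hz.2
  have hlim := (((hT b ⟨hab, le_rfl⟩).sub (hv (fun T => T) (fun T => rfl))).add
    (hv (fun T => -T) (fun T => by simp)))
  simp only [sub_zero, add_zero] at hlim
  refine tendsto_nhds_unique (hT a ⟨le_rfl, hab⟩) (hlim.congr fun T => ?_)
  rw [hR T]

/-- `√2/2` -/
noncomputable def hh : ℝ := Real.sqrt 2 / 2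

lemma hh_sq : hh ^ 2 = 1 / 2 := by
  unfold hh; rw [div_pow, Real.sq_sqrt (by norm_num)]; norm_num

lemma hh_pos : 0 < hh := by unfold hh; positivity

lemma hh_bd : 0.7071 < hh ∧ hh < 0.7072 := by
  have h1 := hh_sq
  have h2 := hh_pos
  constructor <;> nlinarith

/-- `π/√2` -/
noncomputable def om : ℝ := Real.pi * hh

lemma om_pos : 0 < om := mul_pos Real.pi_pos hh_pos

lemma om_sq : om ^ 2 = Real.pi ^ 2 / 2 := by
  unfold om; rw [mul_pow, hh_sq]; ring

/-- weight -/
noncomputable def EE (t : ℝ) : ℝ := Real.exp (-Real.pi * t ^ 2 - om * t)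

lemma EE_pos (t : ℝ) : 0 < EE t := Real.exp_pos _

lemma EE_cont : Continuous EE := by unfold EE; fun_prop

lemma int_mom (k : ℕ) : IntegrableOn (fun t => t ^ k * EE t) (Set.Ioi 0) := by
  have h := integrableOn_rpow_mul_exp_neg_mul_sq Real.pi_pos (s := k) (by
    have : (0 : ℝ) ≤ k := k.cast_nonneg
    linarith)
  refine Integrable.mono' h ((continuous_pow k).mul EE_cont).aestronglyMeasurable ?_
  refine (ae_restrict_iff' measurableSet_Ioi).2 (Filter.Eventually.of_forall fun t ht => ?_)
  have ht : 0 < t := ht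
  have h1 := om_pos
  rw [Real.norm_of_nonneg (mul_nonneg (by positivity) (EE_pos t).le), Real.rpow_natCast]
  unfold EE
  gcongr
  nlinarith [mul_pos h1 ht]

/-- moments -/
noncomputable def MM (k : ℕ) : ℝ := ∫ t in Set.Ioi 0, t ^ k * EE t

lemma MM_pos (k : ℕ) : 0 < MM k := by
  unfold MM
  rw [setIntegral_pos_iff_support_of_nonneg_ae]
  · have : Set.Ioi (0:ℝ) ⊆ Function.support (fun t => t ^ k * EE t) ∩ Set.Ioi 0 := by
      intro t ht
      refine ⟨?_, ht⟩
      have ht : 0 < t := ht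
      exact (mul_pos (pow_pos ht k) (EE_pos t)).ne'
    refine lt_of_lt_of_le ?_ (measure_mono this)
    simp
  · refine (ae_restrict_iff' measurableSet_Ioi).2 (Filter.Eventually.of_forall fun t ht => ?_)
    have ht : 0 < t := ht
    exact (mul_pos (pow_pos ht k) (EE_pos t)).le
  · exact int_mom k

lemma MM_rec (k : ℕ) : (k + 1) * MM k = 2 * Real.pi * MM (k + 2) + om * MM (k + 1) := by
  have hInt : IntegrableOn (fun t => (k + 1) * (t ^ k * EE t) - 2 * Real.pi * (t ^ (k + 2) * EE t)
      - om * (t ^ (k + 1) * EE t)) (Set.Ioi 0) :=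
    (((int_mom k).const_mul _).sub ((int_mom (k+2)).const_mul _)).sub ((int_mom (k+1)).const_mul _)
  have hd : ∀ t ∈ Set.Ici (0:ℝ), HasDerivAt (fun t => t ^ (k + 1) * EE t)
      ((k + 1) * (t ^ k * EE t) - 2 * Real.pi * (t ^ (k + 2) * EE t)
      - om * (t ^ (k + 1) * EE t)) t := by
    intro t _
    have h1 : HasDerivAt EE (EE t * (-Real.pi * (2 * t) - om)) t := by
      unfold EE
      apply HasDerivAt.exp
      have := ((hasDerivAt_pow 2 t).const_mul (-Real.pi)).fun_sub ((hasDerivAt_id t).const_mul om)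
      simpa using this
    refine ((hasDerivAt_pow (k + 1) t).fun_mul h1).congr_deriv ?_
    push_cast
    ring
  have hlim : Filter.Tendsto (fun t => t ^ (k + 1) * EE t) Filter.atTop (nhds 0) := by
    have h := (Real.tendsto_pow_mul_exp_neg_atTop_nhds_zero (k + 1)).comp
      (Filter.tendsto_id)
    refine squeeze_zero' ?_ ?_ h
    · filter_upwards [Filter.eventually_ge_atTop 0] with t ht
      exact mul_nonneg (by positivity) (EE_pos t).le
    · filter_upwards [Filter.eventually_ge_atTop 1] with t ht
      have h1 := om_pos
      have h2 := Real.pi_gt_three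
      simp only [Function.comp, id]
      unfold EE
      gcongr
      nlinarith [mul_pos h1 (by linarith : 0 < t)]
  have := integral_Ioi_of_hasDerivAt_of_tendsto' hd hInt hlim
  rw [integral_sub, integral_sub, integral_const_mul, integral_const_mul, integral_const_mul] at this
  · simp at this
    unfold MM
    linarith
  · exact ((int_mom k).const_mul _)
  · exact ((int_mom (k+2)).const_mul _)
  · exact ((int_mom k).const_mul _).sub ((int_mom (k+2)).const_mul _)
  · exact ((int_mom (k+1)).const_mul _)

lemma MM_cs (k : ℕ) : MM (k + 1) ^ 2 ≤ MM k * MM (k + 2) := by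
  have h : ∀ x : ℝ, 0 ≤ MM (k + 2) - 2 * x * MM (k + 1) + x ^ 2 * MM k := by
    intro x
    have h1 : 0 ≤ ∫ t in Set.Ioi 0, ((t ^ (k + 2) * EE t - 2 * x * (t ^ (k + 1) * EE t))
        + x ^ 2 * (t ^ k * EE t)) := by
      refine setIntegral_nonneg measurableSet_Ioi fun t ht => ?_
      have ht : 0 < t := ht
      have : (t ^ (k + 2) * EE t - 2 * x * (t ^ (k + 1) * EE t)) + x ^ 2 * (t ^ k * EE t)
        = t ^ k * EE t * (t - x) ^ 2 := by ring
      rw [this]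
      have := EE_pos t
      positivity
    rw [integral_add, integral_sub, integral_const_mul, integral_const_mul] at h1
    · exact h1
    · exact int_mom _
    · exact (int_mom _).const_mul _
    · exact (int_mom _).sub ((int_mom _).const_mul _)
    · exact (int_mom _).const_mul _
  have h0 := MM_pos k
  have := h (MM (k + 1) / MM k)
  field_simp at this
  nlinarith

lemma arith_big (N r μ v : ℝ) (hN : 4 ≤ N) (hμ : 0 < μ) (h1 : N * r = 2 * Real.pi * μ + om)
    (h2 : N + 1 = 2 * Real.pi * v + om * μ) (h3 : 1 ≤ r * μ) (h4 : μ ^ 2 ≤ v) :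
    0 < 1 - om ^ 2 / 2 * (v - μ ^ 2) - r / (2 * om) := by
  have hp1 := Real.pi_gt_d2
  have hp2 := Real.pi_lt_d2
  have ho := om_pos
  have hh1 := hh_bd
  have A : v - μ ^ 2 ≤ 1 / (2 * Real.pi) := by
    rw [le_div_iff₀ (by positivity)]
    nlinarith
  have A2 : om ^ 2 / 2 * (v - μ ^ 2) ≤ Real.pi / 8 := by
    calc om ^ 2 / 2 * (v - μ ^ 2) ≤ om ^ 2 / 2 * (1 / (2 * Real.pi)) := by gcongr
      _ = Real.pi / 8 := by rw [om_sq]; field_simp; norm_num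
  have B : r / (2 * om) = 2 * hh * (μ / N) + 1 / (2 * N) := by
    have hN0 : N ≠ 0 := by linarith
    have : r = (2 * Real.pi * μ + om) / N := by field_simp; linarith
    rw [this]
    have h5 := hh_sq
    have h6 := hh_pos
    have h7 := Real.pi_pos
    unfold om
    field_simp
    linear_combination (-4*μ) * h5
  have C1 : 1 / (2 * N) ≤ 1 / 8 := by
    apply one_div_le_one_div_of_le <;> linarith
  have D1 : μ / N ≤ 0.224 := by
    rw [div_le_iff₀ (by linarith)]
    have : 2 * Real.pi * μ ^ 2 ≤ N + 1 := by nlinarith [mul_pos ho hμ]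
    have : 6.28 * μ ^ 2 ≤ N + 1 := by nlinarith [sq_nonneg μ]
    nlinarith
  have D0 : 0 < μ / N := by apply div_pos <;> linarith
  rw [B]
  nlinarith

lemma arith_two (r μ v : ℝ) (hμ : 0 < μ) (h1 : 2 * r = 2 * Real.pi * μ + om)
    (h2 : 2 + 1 = 2 * Real.pi * v + om * μ) (h3 : 1 ≤ r * μ) (h4 : μ ^ 2 ≤ v) :
    0 < 1 - om ^ 2 / 2 * (v - μ ^ 2) - r / (2 * om) + 3 / 8 - om * μ / 8 := by
  have hp1 := Real.pi_gt_d2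
  have hp2 := Real.pi_lt_d2
  have ho := om_pos
  have hh1 := hh_bd
  have A : v - μ ^ 2 ≤ 1 / (2 * Real.pi) := by
    rw [le_div_iff₀ (by positivity)]
    nlinarith
  have A2 : om ^ 2 / 2 * (v - μ ^ 2) ≤ Real.pi / 8 := by
    calc om ^ 2 / 2 * (v - μ ^ 2) ≤ om ^ 2 / 2 * (1 / (2 * Real.pi)) := by gcongr
      _ = Real.pi / 8 := by rw [om_sq]; field_simp; norm_num
  have B : r / (2 * om) = hh * μ + 1 / 4 := by
    have : r = (2 * Real.pi * μ + om) / 2 := by linarith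
    rw [this]
    have h5 := hh_sq
    have h6 := hh_pos
    have h7 := Real.pi_pos
    unfold om
    field_simp
    linear_combination (-16*μ) * h5
  have o1 : 2.22 < om := by unfold om; nlinarith
  have o2 : om < 2.23 := by unfold om; nlinarith
  have D1 : μ ≤ 0.55 := by
    have : 2 * Real.pi * μ ^ 2 + om * μ ≤ 3 := by nlinarith
    have : 6.28 * μ ^ 2 + 2.22 * μ ≤ 3 := by nlinarith [sq_nonneg μ]
    nlinarith
  rw [B]
  nlinarith

/-- the elementary bound for `1/(e^y-1)`, two versions -/
lemma rho_bd (ρ y : ℝ) (hy : 0 < y) (hρ : ρ ^ 2 = Real.exp (-y)) :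
    ρ ^ 2 / (1 - ρ ^ 2) ≤ 1 / y ∧ ρ ^ 2 / (1 - ρ ^ 2) ≤ 1 / y - 3 / 8 + y / 16 := by
  have h1 := Real.quadratic_le_exp_of_nonneg hy.le
  have h2 : ρ ^ 2 / (1 - ρ ^ 2) = 1 / (Real.exp y - 1) := by
    rw [hρ, Real.exp_neg]
    have : Real.exp y - 1 ≠ 0 := by nlinarith [sq_nonneg y]
    field_simp
  have h3 : ρ ^ 2 / (1 - ρ ^ 2) ≤ 1 / (y + y ^ 2 / 2) := by
    rw [h2]; apply one_div_le_one_div_of_le (by positivity); linarith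
  constructor
  · refine h3.trans ?_
    apply one_div_le_one_div_of_le hy; nlinarith [sq_nonneg y]
  · refine h3.trans ?_
    have : 1 / y - 3 / 8 + y / 16 - 1 / (y + y ^ 2 / 2) = (y - 2) ^ 2 / (16 * (y + 2)) := by
      field_simp; ring
    have h5 : 0 ≤ (y - 2) ^ 2 / (16 * (y + 2)) := by positivity
    linarith

/-- `e^{iπ/4}` -/
noncomputable def ee : ℂ := Complex.exp (Real.pi * Complex.I / 4)

lemma ee_eq : ee = (hh : ℂ) + (hh : ℂ) * Complex.I := by
  unfold ee hh
  rw [show (Real.pi * Complex.I / 4 : ℂ) = ((Real.pi / 4 : ℝ) : ℂ) * Complex.I by push_cast; ring,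
    Complex.exp_mul_I, ← Complex.ofReal_cos, ← Complex.ofReal_sin, Real.cos_pi_div_four,
    Real.sin_pi_div_four]

lemma hhc_sq : (hh : ℂ) ^ 2 = 1 / 2 := by
  rw [← Complex.ofReal_pow, hh_sq]; norm_num

lemma ee_sq : ee ^ 2 = Complex.I := by
  rw [ee_eq]
  linear_combination (2 * Complex.I + Complex.I ^ 2 + 1) * hhc_sq + (1/2) * Complex.I_sq

lemma ee_ne : ee ≠ 0 := Complex.exp_ne_zero _

/-- the denominator -/
noncomputable def DD (x : ℂ) : ℂ :=
  Complex.exp (Real.pi * Complex.I * x) - Complex.exp (-(Real.pi * Complex.I * x))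

lemma DD_neg (x : ℂ) : DD (-x) = -DD x := by
  unfold DD; rw [mul_neg, neg_neg]; ring

lemma DD_diff : Differentiable ℂ DD := by unfold DD; fun_prop

lemma DD_zero : DD 0 = 0 := by simp [DD]

lemma DD_deriv_zero : deriv DD 0 = 2 * Real.pi * Complex.I := by
  have h : HasDerivAt DD (Real.pi * Complex.I * 1 * 1 - (-(Real.pi * Complex.I * 1)) * 1) 0 := by
    unfold DD
    have h0 : HasDerivAt (fun x : ℂ => Real.pi * Complex.I * x) (Real.pi * Complex.I * 1) 0 :=
      (hasDerivAt_id (0:ℂ)).const_mul _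
    have h1 := h0.cexp
    have h2 := h0.fun_neg.cexp
    refine (h1.fun_sub h2).congr_deriv ?_
    simp
  rw [h.deriv]; ring

lemma DD_ne (x : ℂ) (hx : ∀ k : ℤ, x ≠ k) : DD x ≠ 0 := by
  unfold DD
  rw [sub_ne_zero]
  intro h
  rw [Complex.exp_eq_exp_iff_exists_int] at h
  obtain ⟨k, hk⟩ := h
  apply hx k
  have : (2 * Real.pi * Complex.I : ℂ) ≠ 0 := by
    simp [Real.pi_ne_zero]
  apply mul_left_cancel₀ this
  linear_combination hk

lemma ee_mul_re (z : ℂ) : (ee * z).re = hh * (z.re - z.im) := by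
  rw [ee_eq]; simp; ring

lemma ee_mul_im (z : ℂ) : (ee * z).im = hh * (z.re + z.im) := by
  rw [ee_eq]; simp; ring

lemma DD_ne_strip (z : ℂ) (hz : z ≠ 0) (h1 : -(hh / 2) ≤ z.im) (h2 : z.im ≤ 0) :
    DD (ee * z) ≠ 0 := by
  apply DD_ne
  intro k hk
  have hp := hh_pos
  have hsq := hh_sq
  have hre := congrArg Complex.re hk
  have him := congrArg Complex.im hk
  rw [ee_mul_re] at hre
  rw [ee_mul_im] at him
  simp at hre him
  have h3 : z.re = - z.im := by
    rcases him with h | h <;> linarith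
  have h4 : (k : ℝ) = -2 * hh * z.im := by rw [← hre, h3]; ring
  have h5 : (k : ℝ) < 1 := by nlinarith
  have h6 : (-1 : ℝ) < k := by nlinarith
  have h7 : k < 1 := by exact_mod_cast h5
  have h8 : -1 < k := by exact_mod_cast h6
  have h9 : k = 0 := by omega
  rw [h9] at hk
  simp [ee_ne, hz] at hk

/-- the integrand in the rotated coordinate -/
noncomputable def FF (s z : ℂ) : ℂ :=
  (ee * z) ^ (-s) * Complex.exp (Real.pi * Complex.I * (ee * z) ^ 2) / DD (ee * z)

lemma slit (z : ℂ) (hz : z ≠ 0) (h2 : z.im ≤ 0) : 0 < (ee * z).re ∨ (ee * z).im ≠ 0 := by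
  rw [ee_mul_re, ee_mul_im]
  have hp := hh_pos
  by_contra! h
  have h3 : z.re + z.im = 0 := by
    rcases mul_eq_zero.1 h.2 with h | h <;> linarith
  have h4 : z.re - z.im ≤ 0 := by
    by_contra! h'
    have := mul_pos hp h'
    linarith [h.1]
  apply hz
  apply Complex.ext <;> simp <;> linarith

lemma FF_eq (s z : ℂ) (hs : s.re < -1) :
    FF s z = (ee * z) ^ (-s - 1) * Complex.exp (Real.pi * Complex.I * (ee * z) ^ 2) /
      dslope DD 0 (ee * z) := by
  have hs0 : -s ≠ 0 := by
    intro h; have := congrArg Complex.re h; simp at this; linarith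
  have hs1 : -s - 1 ≠ 0 := by
    intro h; have := congrArg Complex.re h; simp at this; linarith
  unfold FF
  by_cases hz : z = 0
  · simp [hz, Complex.zero_cpow hs0, Complex.zero_cpow hs1]
  · have hx : ee * z ≠ 0 := mul_ne_zero ee_ne hz
    rw [dslope_of_ne _ hx, slope_def_field, DD_zero, Complex.cpow_sub _ _ hx, Complex.cpow_one]
    simp only [sub_zero]
    by_cases hD : DD (ee * z) = 0
    · simp [hD]
    · generalize (ee * z) ^ (-s) = P
      generalize ee * z = x at *
      field_simp

lemma dslope_ne (z : ℂ) (h1 : -(hh / 2) ≤ z.im) (h2 : z.im ≤ 0) : dslope DD 0 (ee * z) ≠ 0 := by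
  by_cases hz : z = 0
  · rw [hz, mul_zero, dslope_same, DD_deriv_zero]
    simp [Real.pi_ne_zero]
  · have hx : ee * z ≠ 0 := mul_ne_zero ee_ne hz
    rw [dslope_of_ne _ hx, slope_def_field, DD_zero, sub_zero, sub_zero]
    exact div_ne_zero (DD_ne_strip z hz h1 h2) hx

lemma dslope_cont : Continuous (dslope DD 0) := by
  rw [← continuousOn_univ, continuousOn_dslope Filter.univ_mem]
  exact ⟨DD_diff.continuous.continuousOn, DD_diff 0⟩

lemma FF_cont (s : ℂ) (hs : s.re < -1) :
    ContinuousOn (FF s) {z | z.im ∈ Set.Icc (-(hh / 2)) 0} := by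
  rw [show FF s = fun z => _ from funext fun z => FF_eq s z hs]
  refine ContinuousOn.div (ContinuousOn.mul ?_ (by fun_prop)) ?_ ?_
  · intro z hz
    have hz2 : z.im ≤ 0 := hz.2
    have hc : 0 ≤ (ee * z).re ∨ (ee * z).im ≠ 0 := by
      by_cases h0 : z = 0
      · simp [h0]
      · exact (slit z h0 hz2).imp le_of_lt id
    have := Complex.continuousAt_cpow_const_of_re_pos (w := -s - 1) hc (by simp; linarith)
    refine ContinuousAt.continuousWithinAt ?_
    exact ContinuousAt.comp (f := fun z => ee * z) this (by fun_prop)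
  · exact (dslope_cont.comp (by fun_prop)).continuousOn
  · intro z hz
    exact dslope_ne z hz.1 hz.2

lemma FF_diff (s : ℂ) : DifferentiableOn ℂ (FF s) {z | z.im ∈ Set.Ioo (-(hh / 2)) 0} := by
  intro z hz
  have hz1 : -(hh / 2) < z.im := hz.1
  have hz2 : z.im < 0 := hz.2
  have h0 : z ≠ 0 := by rintro rfl; simp at hz2
  refine DifferentiableAt.differentiableWithinAt ?_
  unfold FF
  refine DifferentiableAt.fun_div (DifferentiableAt.fun_mul ?_ (by fun_prop)) ?_ ?_
  · refine DifferentiableAt.cpow_const (by fun_prop) ?_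
    exact slit z h0 hz2.le
  · exact DifferentiableAt.comp (f := fun z => ee * z) z (DD_diff _) (by fun_prop)
  · exact DD_ne_strip z h0 hz1.le hz2.le

lemma exp_sq_eq (z : ℂ) : Complex.exp (Real.pi * Complex.I * (ee * z) ^ 2)
    = Complex.exp (-Real.pi * z ^ 2) := by
  congr 1
  rw [mul_pow, ee_sq]
  linear_combination (Real.pi * z ^ 2) * Complex.I_sq

lemma norm_DD_ge (x : ℂ) : 2 * Real.pi * |x.im| ≤ ‖DD x‖ := by
  have key : |Real.exp (-(Real.pi * x.im)) - Real.exp (Real.pi * x.im)| ≤ ‖DD x‖ := by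
    have := abs_norm_sub_norm_le (Complex.exp (Real.pi * Complex.I * x))
      (Complex.exp (-(Real.pi * Complex.I * x)))
    simpa [Complex.norm_exp, DD] using this
  refine le_trans ?_ key
  have h : ∀ a : ℝ, 0 ≤ a → 2 * a ≤ Real.exp a - Real.exp (-a) := by
    intro a ha
    have := Real.self_le_sinh_iff.2 ha
    rw [Real.sinh_eq] at this
    linarith
  have hp := Real.pi_pos
  rcases le_total 0 x.im with hx | hx
  · rw [abs_of_nonneg hx, abs_sub_comm]
    have := h (Real.pi * x.im) (by positivity)
    exact le_trans (by linarith) (le_abs_self _)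
  · rw [abs_of_nonpos hx]
    have := h (-(Real.pi * x.im)) (by nlinarith)
    rw [neg_neg] at this
    exact le_trans (by linarith) (le_abs_self _)

lemma norm_ee : ‖ee‖ = 1 := by
  unfold ee
  rw [show (Real.pi * Complex.I / 4 : ℂ) = ((Real.pi / 4 : ℝ) : ℂ) * Complex.I by push_cast; ring,
    Complex.norm_exp_ofReal_mul_I]

lemma FF_tail (s : ℂ) (hs : s.re < -1) : ∃ C : ℝ, ∀ z : ℂ, z.im ∈ Set.Icc (-(hh / 2)) 0 →
    1 ≤ |z.re| → ‖FF s z‖ ≤ C * Real.exp (-z.re ^ 2) := by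
  refine ⟨Real.exp (s.re ^ 2 / 4) * Real.exp (Real.pi * |s.im|) * Real.exp 4, ?_⟩
  intro z hz hre
  have hb := hh_bd
  have hz1 : -(hh / 2) ≤ z.im := hz.1
  have hz2 : z.im ≤ 0 := hz.2
  have h0 : z ≠ 0 := by rintro rfl; simp at hre; linarith
  have hx : ee * z ≠ 0 := mul_ne_zero ee_ne h0
  have hp3 := Real.pi_gt_three
  have hD : 1 ≤ ‖DD (ee * z)‖ := by
    refine le_trans ?_ (norm_DD_ge _)
    rw [ee_mul_im, abs_mul, abs_of_pos hh_pos]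
    have : 1 / 2 ≤ |z.re + z.im| := by
      have := abs_sub_abs_le_abs_sub z.re (-z.im)
      rw [abs_neg, abs_of_nonpos hz2, show z.re - -z.im = z.re + z.im by ring] at this
      norm_num at hb ⊢
      linarith
    norm_num at hb
    have h3 : 0.7 * (1 / 2) ≤ hh * |z.re + z.im| := by
      apply mul_le_mul <;> linarith
    nlinarith
  have hE : ‖Complex.exp (Real.pi * Complex.I * (ee * z) ^ 2)‖ ≤ Real.exp 4 * Real.exp (-2 * z.re ^ 2) := by
    rw [exp_sq_eq, Complex.norm_exp, ← Real.exp_add]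
    apply Real.exp_le_exp.2
    have : (-(Real.pi:ℂ) * z ^ 2).re = -Real.pi * (z.re ^ 2 - z.im ^ 2) := by
      rw [← Complex.ofReal_neg, Complex.re_ofReal_mul, sq z, Complex.mul_re]; ring
    rw [this]
    have : z.im ^ 2 ≤ 1 := by nlinarith
    nlinarith [Real.pi_lt_four, sq_nonneg z.re, sq_nonneg z.im]
  have hP : ‖(ee * z) ^ (-s)‖ ≤ Real.exp (s.re ^ 2 / 4) * Real.exp (Real.pi * |s.im|) * Real.exp (z.re ^ 2) := by
    rw [Complex.norm_cpow_of_ne_zero hx, norm_mul, norm_ee, one_mul, div_eq_mul_inv, ← Real.exp_neg]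
    have h5 : ‖z‖ ≤ Real.exp |z.re| := by
      have h6 := Complex.norm_le_abs_re_add_abs_im z
      have h7 : |z.im| ≤ 1 := by rw [abs_of_nonpos hz2]; linarith
      have := Real.add_one_le_exp |z.re|
      linarith
    have h8 : ‖z‖ ^ (-s).re ≤ Real.exp (s.re ^ 2 / 4) * Real.exp (z.re ^ 2) := by
      calc ‖z‖ ^ (-s).re ≤ (Real.exp |z.re|) ^ (-s).re := by
            apply Real.rpow_le_rpow (norm_nonneg _) h5
            simp; linarith
        _ = Real.exp (|z.re| * (-s).re) := by rw [← Real.exp_mul]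
        _ ≤ _ := by
            rw [← Real.exp_add]
            apply Real.exp_le_exp.2
            simp only [Complex.neg_re]
            rw [← sq_abs z.re]
            nlinarith [sq_nonneg (|z.re| + s.re / 2)]
    have h9 : Real.exp (-(Complex.arg (ee * z) * (-s).im)) ≤ Real.exp (Real.pi * |s.im|) := by
      apply Real.exp_le_exp.2
      simp only [Complex.neg_im, mul_neg, neg_neg]
      refine (le_abs_self _).trans ?_
      rw [abs_mul]
      gcongr
      exact Complex.abs_arg_le_pi _
    calc _ ≤ (Real.exp (s.re ^ 2 / 4) * Real.exp (z.re ^ 2)) * Real.exp (Real.pi * |s.im|) := by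
          gcongr
      _ = _ := by ring
  unfold FF
  rw [norm_div, norm_mul]
  calc _ ≤ ‖(ee * z) ^ (-s)‖ * ‖Complex.exp (Real.pi * Complex.I * (ee * z) ^ 2)‖ :=
        div_le_self (by positivity) hD
    _ ≤ (Real.exp (s.re ^ 2 / 4) * Real.exp (Real.pi * |s.im|) * Real.exp (z.re ^ 2)) *
        (Real.exp 4 * Real.exp (-2 * z.re ^ 2)) := by gcongr
    _ = Real.exp (s.re ^ 2 / 4) * Real.exp (Real.pi * |s.im|) * Real.exp 4 *
        (Real.exp (z.re ^ 2) * Real.exp (-2 * z.re ^ 2)) := by ring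
    _ = _ := by rw [← Real.exp_add (z.re ^ 2)]; ring_nf

lemma FF_bound (s : ℂ) (hs : s.re < -1) : ∃ C : ℝ, ∀ z : ℂ, z.im ∈ Set.Icc (-(hh / 2)) 0 →
    ‖FF s z‖ ≤ C * Real.exp (-z.re ^ 2) := by
  obtain ⟨C, hC⟩ := FF_tail s hs
  have hK : IsCompact (Set.Icc (-1:ℝ) 1 ×ℂ Set.Icc (-(hh / 2)) 0) :=
    isCompact_Icc.reProdIm isCompact_Icc
  obtain ⟨B, hB⟩ := hK.exists_bound_of_continuousOn ((FF_cont s hs).mono (fun z hz => by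
    rw [Complex.mem_reProdIm] at hz; exact hz.2))
  refine ⟨max C (|B| * Real.exp 1), fun z hz => ?_⟩
  rcases le_total 1 |z.re| with h | h
  · refine (hC z hz h).trans ?_
    gcongr
    exact le_max_left _ _
  · have h1 := hB z (by rw [Complex.mem_reProdIm]; exact ⟨abs_le.1 h, hz⟩)
    have h2 : |B| * Real.exp 1 * Real.exp (-z.re ^ 2) ≤
        max C (|B| * Real.exp 1) * Real.exp (-z.re ^ 2) := by
      gcongr
      exact le_max_right _ _
    refine le_trans (h1.trans (le_abs_self B)) (le_trans ?_ h2)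
    rw [mul_assoc, ← Real.exp_add]
    apply le_mul_of_one_le_right (abs_nonneg _)
    apply Real.one_le_exp
    have : z.re ^ 2 ≤ 1 := by rw [← sq_abs]; nlinarith [abs_nonneg z.re]
    linarith

/-- Mellin kernel -/
noncomputable def ff (t : ℝ) : ℂ := Complex.exp (-Real.pi * (t : ℂ) ^ 2) / DD (ee * t)

lemma log_ee : Complex.log ee = Real.pi * Complex.I / 4 := by
  have := Real.pi_pos
  unfold ee
  apply Complex.log_exp <;> simp <;> linarith

lemma log_neg_ee : Complex.log (-ee) = -(3 * Real.pi * Complex.I / 4) := by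
  have hp := Real.pi_pos
  have : -ee = Complex.exp (-(3 * Real.pi * Complex.I / 4)) := by
    unfold ee
    rw [show (-(3 * Real.pi * Complex.I / 4) : ℂ) = Real.pi * Complex.I / 4 - Real.pi * Complex.I by ring,
      Complex.exp_sub, Complex.exp_pi_mul_I]
    ring
  rw [this]
  apply Complex.log_exp <;> simp <;> linarith

lemma cpow_pos_ray (s : ℂ) (t : ℝ) (ht : 0 < t) :
    (ee * t) ^ (-s) = Complex.exp (-(Real.pi * Complex.I / 4) * s) * (t : ℂ) ^ (-s) := by
  have ht' : (t : ℂ) ≠ 0 := by exact_mod_cast ht.ne'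
  rw [Complex.cpow_def_of_ne_zero (mul_ne_zero ee_ne ht'), Complex.cpow_def_of_ne_zero ht',
    mul_comm ee, Complex.log_ofReal_mul ht ee_ne, log_ee, ← Complex.exp_add, Complex.ofReal_log ht.le]
  congr 1; ring

lemma cpow_neg_ray (s : ℂ) (t : ℝ) (ht : 0 < t) :
    (ee * ((-t : ℝ) : ℂ)) ^ (-s) = Complex.exp ((3 * Real.pi * Complex.I / 4) * s) * (t : ℂ) ^ (-s) := by
  have ht' : (t : ℂ) ≠ 0 := by exact_mod_cast ht.ne'
  rw [show ee * ((-t : ℝ) : ℂ) = (t : ℂ) * (-ee) by push_cast; ring,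
    Complex.cpow_def_of_ne_zero (mul_ne_zero ht' (neg_ne_zero.2 ee_ne)), Complex.cpow_def_of_ne_zero ht',
    Complex.log_ofReal_mul ht (neg_ne_zero.2 ee_ne), log_neg_ee, ← Complex.exp_add,
    Complex.ofReal_log ht.le]
  congr 1; ring

lemma FF_pos (s : ℂ) (t : ℝ) (ht : 0 < t) :
    FF s t = Complex.exp (-(Real.pi * Complex.I / 4) * s) * ((t : ℂ) ^ (-s) * ff t) := by
  unfold FF ff
  rw [exp_sq_eq, cpow_pos_ray s t ht]
  ring

lemma FF_neg (s : ℂ) (t : ℝ) (ht : 0 < t) :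
    FF s ((-t : ℝ) : ℂ) = -Complex.exp ((3 * Real.pi * Complex.I / 4) * s) * ((t : ℂ) ^ (-s) * ff t) := by
  unfold FF ff
  rw [exp_sq_eq, cpow_neg_ray s t ht, show ee * ((-t : ℝ) : ℂ) = -(ee * t) by push_cast; ring, DD_neg]
  push_cast
  rw [neg_sq]
  ring

lemma FF_int (s : ℂ) (hs : s.re < -1) : Integrable (fun x : ℝ => FF s x) := by
  obtain ⟨C, hC⟩ := FF_bound s hs
  have hm : ∀ x : ℝ, (x : ℂ).im ∈ Set.Icc (-(hh / 2)) 0 := by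
    intro x; have := hh_pos; simp; linarith
  have h1 : Integrable (fun x : ℝ => C * Real.exp (-1 * x ^ 2)) :=
    (integrable_exp_neg_mul_sq one_pos).const_mul C
  refine h1.mono' ?_ ?_
  · exact ((FF_cont s hs).comp_continuous Complex.continuous_ofReal hm).aestronglyMeasurable
  · refine Filter.Eventually.of_forall fun x => ?_
    simpa using hC x (hm x)

lemma R_eq (s : ℂ) (hs : s.re < -1) : RiemannR s = -ee *
    ((Complex.exp (-(Real.pi * Complex.I / 4) * s) - Complex.exp ((3 * Real.pi * Complex.I / 4) * s))
      * mellin ff (1 - s)) := by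
  have hp := hh_pos
  obtain ⟨C, hC⟩ := FF_bound s hs
  have h1 := shift_line (FF s) (-(hh / 2)) 0 (by linarith) C (FF_cont s hs) (FF_diff s) hC
  have h2 : RiemannR s = -ee * ∫ u : ℝ, FF s (((hh / 2 - u : ℝ) : ℂ) + ((-(hh / 2) : ℝ) : ℂ) * Complex.I) := by
    unfold RiemannR
    congr 1
    refine integral_congr_ae (Filter.Eventually.of_forall fun u => ?_)
    have : rline u = ee * (((hh / 2 - u : ℝ) : ℂ) + ((-(hh / 2) : ℝ) : ℂ) * Complex.I) := by
      unfold rline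
      change 1 / 2 - ee * (u : ℂ) = _
      push_cast
      have h3 := hhc_sq
      have : ee * (hh / 2 - hh / 2 * Complex.I) = 1 / 2 := by
        rw [ee_eq]
        linear_combination (1/2 - Complex.I ^ 2 / 2) * h3 - (1/4) * Complex.I_sq
      linear_combination -this
    simp only [FF, DD, this]
  rw [h2]
  congr 1
  rw [integral_sub_left_eq_self (fun x : ℝ => FF s ((x : ℂ) + ((-(hh / 2) : ℝ) : ℂ) * Complex.I)) volume (hh / 2), h1]
  simp only [Complex.ofReal_zero, zero_mul, add_zero]
  have hi := FF_int s hs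
  rw [← intervalIntegral.integral_Iic_add_Ioi (b := (0:ℝ)) hi.integrableOn hi.integrableOn]
  have h4 : ∫ x : ℝ in Set.Iic 0, FF s x = ∫ x : ℝ in Set.Ioi 0, FF s ((-x : ℝ) : ℂ) := by
    have := integral_comp_neg_Ioi 0 (fun x : ℝ => FF s x)
    rw [neg_zero] at this
    exact this.symm
  have hm : mellin ff (1 - s) = ∫ t : ℝ in Set.Ioi 0, (t : ℂ) ^ (-s) * ff t := by
    unfold mellin
    simp only [smul_eq_mul, show 1 - s - 1 = -s by ring]
  rw [h4, hm, sub_mul, setIntegral_congr_fun measurableSet_Ioi (fun t ht => FF_neg s t ht),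
    setIntegral_congr_fun measurableSet_Ioi (fun t ht => FF_pos s t ht),
    integral_const_mul, integral_const_mul]
  ring

lemma DD_ray_ne (t : ℝ) (ht : 0 < t) : DD (ee * t) ≠ 0 := by
  have := hh_pos
  apply DD_ne_strip
  · exact_mod_cast ht.ne'
  · simp; linarith
  · simp

lemma ff_cont : ContinuousOn ff (Set.Ioi 0) := by
  unfold ff
  refine ContinuousOn.div (by fun_prop) ?_ fun t ht => DD_ray_ne t ht
  exact (DD_diff.continuous.comp (by fun_prop)).continuousOn

lemma ff_norm (t : ℝ) (ht : 0 < t) : ‖ff t‖ ≤ Real.exp (-Real.pi * t ^ 2) * t⁻¹ := by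
  unfold ff
  have h1 := norm_DD_ge (ee * t)
  rw [ee_mul_im] at h1
  simp only [Complex.ofReal_re, Complex.ofReal_im, add_zero] at h1
  have hb := hh_bd
  norm_num at hb
  have hp := Real.pi_gt_three
  rw [abs_of_pos (mul_pos hh_pos ht)] at h1
  have h2 : t ≤ ‖DD (ee * t)‖ := by
    refine le_trans ?_ h1
    have : 1 ≤ 2 * Real.pi * hh := by nlinarith
    nlinarith
  have h3 : ‖Complex.exp (-Real.pi * (t : ℂ) ^ 2)‖ = Real.exp (-Real.pi * t ^ 2) := by
    rw [Complex.norm_exp]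
    congr 1
    rw [← Complex.ofReal_neg, ← Complex.ofReal_pow, ← Complex.ofReal_mul, Complex.ofReal_re]
  rw [norm_div, h3, div_eq_mul_inv]
  gcongr

lemma mellin_diff (s : ℂ) (hs : 1 < s.re) : DifferentiableAt ℂ (mellin ff) s := by
  refine mellin_differentiableAt_of_isBigO_rpow_exp (a := 1) (b := 1) one_pos
    (ff_cont.locallyIntegrableOn measurableSet_Ioi) ?_ ?_ hs
  · refine Asymptotics.IsBigO.of_bound 1 ?_
    filter_upwards [Filter.eventually_ge_atTop 1] with t ht
    refine (ff_norm t (by linarith)).trans ?_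
    have h1 : t⁻¹ ≤ 1 := inv_le_one_of_one_le₀ ht
    have h2 : Real.exp (-Real.pi * t ^ 2) ≤ Real.exp (-1 * t) := by
      apply Real.exp_le_exp.2
      nlinarith [Real.pi_gt_three]
    rw [Real.norm_of_nonneg (Real.exp_pos _).le, one_mul]
    calc _ ≤ Real.exp (-1 * t) * 1 := by gcongr
      _ = _ := mul_one _
  · refine Asymptotics.IsBigO.of_bound 1 ?_
    filter_upwards [self_mem_nhdsWithin] with t ht
    have ht : 0 < t := ht
    refine (ff_norm t ht).trans ?_
    rw [Real.rpow_neg_one, Real.norm_of_nonneg (inv_nonneg.2 ht.le)]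
    gcongr
    apply Real.exp_le_one_iff.2
    nlinarith [Real.pi_gt_three, sq_nonneg t]

lemma ff_lower (m t : ℝ) (ht : 0 < t) :
    EE t * (1 - om ^ 2 / 2 * (t - m) ^ 2 -
      (Real.exp (-om * t)) ^ 2 / (1 - (Real.exp (-om * t)) ^ 2)) ≤
      (-Complex.exp (-(om * m : ℝ) * Complex.I) * ff t).re := by
  set ρ := Real.exp (-om * t) with hρ
  have ho := om_pos
  have hρ0 : 0 < ρ := Real.exp_pos _
  have hρ1 : ρ < 1 := by
    rw [hρ, ← Real.exp_zero]
    exact Real.exp_lt_exp.2 (by nlinarith)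
  set a : ℂ := Complex.exp (((-om * t : ℝ) : ℂ) + ((om * t : ℝ) : ℂ) * Complex.I) with ha
  have hna : ‖a‖ = ρ := by rw [ha, Complex.norm_exp]; simp [hρ]
  have ha0 : a ≠ 0 := Complex.exp_ne_zero _
  have hD : DD (ee * t) = a - a⁻¹ := by
    have : (Real.pi * Complex.I * (ee * t) : ℂ) = ((-om * t : ℝ) : ℂ) + ((om * t : ℝ) : ℂ) * Complex.I := by
      rw [ee_eq]
      unfold om
      push_cast
      linear_combination (Real.pi * hh * t) * Complex.I_sq
    unfold DD
    rw [this, Complex.exp_neg]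
  have hρ2 : 0 < 1 - ρ ^ 2 := by nlinarith
  have hna2 : 1 - ρ ^ 2 ≤ ‖1 - a ^ 2‖ := by
    have := norm_sub_norm_le (1 : ℂ) (a ^ 2)
    rwa [norm_one, norm_pow, hna] at this
  have h1a : 1 - a ^ 2 ≠ 0 := by
    intro h; rw [h, norm_zero] at hna2; linarith
  have hinv : (DD (ee * t))⁻¹ = -(a + a ^ 3 / (1 - a ^ 2)) := by
    rw [hD]
    apply inv_eq_of_mul_eq_one_left
    field_simp
    ring
  set b : ℂ := Complex.exp (-(om * m : ℝ) * Complex.I) with hb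
  have hnb : ‖b‖ = 1 := by
    rw [hb, ← Complex.ofReal_neg, Complex.norm_exp_ofReal_mul_I]
  have hff : -b * ff t = (Real.exp (-Real.pi * t ^ 2) : ℝ) * (b * a + b * a ^ 3 / (1 - a ^ 2)) := by
    unfold ff
    rw [div_eq_mul_inv, hinv]
    push_cast
    ring
  rw [hff, Complex.re_ofReal_mul]
  have hE : EE t = Real.exp (-Real.pi * t ^ 2) * ρ := by
    unfold EE
    rw [hρ, ← Real.exp_add]; congr 1; ring
  rw [hE, mul_assoc]
  gcongr
  have hba : (b * a).re = ρ * Real.cos (om * (t - m)) := by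
    have : b * a = (ρ : ℝ) * Complex.exp ((om * (t - m) : ℝ) * Complex.I) := by
      rw [hb, ha, hρ, Complex.ofReal_exp, ← Complex.exp_add, ← Complex.exp_add]
      congr 1
      push_cast
      ring
    rw [this, Complex.re_ofReal_mul, Complex.exp_ofReal_mul_I_re]
  have hrest : -(ρ * (ρ ^ 2 / (1 - ρ ^ 2))) ≤ (b * a ^ 3 / (1 - a ^ 2)).re := by
    have h1 : ‖b * a ^ 3 / (1 - a ^ 2)‖ ≤ ρ * (ρ ^ 2 / (1 - ρ ^ 2)) := by
      rw [norm_div, norm_mul, hnb, one_mul, norm_pow, hna]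
      calc ρ ^ 3 / ‖1 - a ^ 2‖ ≤ ρ ^ 3 / (1 - ρ ^ 2) := by gcongr
        _ = _ := by ring
    have h2 := (abs_le.1 (Complex.abs_re_le_norm (b * a ^ 3 / (1 - a ^ 2)))).1
    linarith
  have hcos := Real.one_sub_sq_div_two_le_cos (x := om * (t - m))
  rw [Complex.add_re, hba]
  have := mul_le_mul_of_nonneg_left hcos hρ0.le
  nlinarith

lemma ker_int (n : ℕ) (hn : 0 < n) :
    IntegrableOn (fun t : ℝ => (t : ℂ) ^ (2 * n) * ff t) (Set.Ioi 0) := by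
  have h := integrableOn_rpow_mul_exp_neg_mul_sq Real.pi_pos (s := ((2 * n - 1 : ℕ) : ℝ)) (by
    have : (0 : ℝ) ≤ ((2 * n - 1 : ℕ) : ℝ) := Nat.cast_nonneg _
    linarith)
  refine Integrable.mono' h ?_ ?_
  · refine ContinuousOn.aestronglyMeasurable ?_ measurableSet_Ioi
    exact ContinuousOn.mul (by fun_prop) ff_cont
  · refine (ae_restrict_iff' measurableSet_Ioi).2 (Filter.Eventually.of_forall fun t ht => ?_)
    have ht : 0 < t := ht
    rw [norm_mul, norm_pow, Complex.norm_real, Real.norm_of_nonneg ht.le, Real.rpow_natCast]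
    calc t ^ (2 * n) * ‖ff t‖ ≤ t ^ (2 * n) * (Real.exp (-Real.pi * t ^ 2) * t⁻¹) := by
          gcongr; exact ff_norm t ht
      _ = _ := by
          have : t ^ (2 * n) = t ^ (2 * n - 1) * t := by
            rw [← pow_succ]; congr 1; omega
          rw [this]; field_simp

lemma nonvanish_aux (p : ℕ) (c d : ℝ)
    (hInt : IntegrableOn (fun t : ℝ => (t : ℂ) ^ (p + 1) * ff t) (Set.Ioi 0))
    (hcd : ∀ t : ℝ, 0 < t → (Real.exp (-om * t)) ^ 2 / (1 - (Real.exp (-om * t)) ^ 2)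
      ≤ 1 / (2 * om * t) - c + d * t)
    (hpos : 0 < (1 + c) - om ^ 2 / 2 * (MM (p + 3) / MM (p + 1) - (MM (p + 2) / MM (p + 1)) ^ 2)
      - (MM p / MM (p + 1)) / (2 * om) - d * (MM (p + 2) / MM (p + 1))) :
    (∫ t : ℝ in Set.Ioi 0, (t : ℂ) ^ (p + 1) * ff t) ≠ 0 := by
  intro h0
  have ho := om_pos
  set m := MM (p + 2) / MM (p + 1) with hm
  set b : ℂ := Complex.exp (-(om * m : ℝ) * Complex.I) with hb
  have hM := MM_pos (p + 1)
  have h1 : ∫ t : ℝ in Set.Ioi 0, (-b * ((t : ℂ) ^ (p + 1) * ff t)).re = 0 := by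
    have h2 := integral_re (hInt.const_mul (-b))
    rw [integral_const_mul, h0, mul_zero] at h2
    simpa using h2
  have i1 := (int_mom (p + 1)).const_mul (1 + c - om ^ 2 / 2 * m ^ 2)
  have i2 := (int_mom (p + 2)).const_mul (om ^ 2 * m - d)
  have i3 := (int_mom (p + 3)).const_mul (om ^ 2 / 2)
  have i0 := (int_mom p).const_mul (1 / (2 * om))
  have i12 : Integrable (fun t : ℝ => (1 + c - om ^ 2 / 2 * m ^ 2) * (t ^ (p + 1) * EE t)
      + (om ^ 2 * m - d) * (t ^ (p + 2) * EE t)) (volume.restrict (Set.Ioi 0)) := i1.add i2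
  have i123 : Integrable (fun t : ℝ => (1 + c - om ^ 2 / 2 * m ^ 2) * (t ^ (p + 1) * EE t)
      + (om ^ 2 * m - d) * (t ^ (p + 2) * EE t) - om ^ 2 / 2 * (t ^ (p + 3) * EE t))
      (volume.restrict (Set.Ioi 0)) := i12.sub i3
  have hle : ∫ t : ℝ in Set.Ioi 0, ((1 + c - om ^ 2 / 2 * m ^ 2) * (t ^ (p + 1) * EE t)
      + (om ^ 2 * m - d) * (t ^ (p + 2) * EE t) - om ^ 2 / 2 * (t ^ (p + 3) * EE t)
      - 1 / (2 * om) * (t ^ p * EE t)) ≤ 0 := by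
    refine le_trans ?_ h1.le
    refine setIntegral_mono_on (i123.sub i0) (hInt.const_mul (-b)).re
      measurableSet_Ioi fun t ht => ?_
    have ht : 0 < t := ht
    have h3 := ff_lower m t ht
    have h4 := hcd t ht
    have h5 : (-b * ((t : ℂ) ^ (p + 1) * ff t)).re = t ^ (p + 1) * (-b * ff t).re := by
      rw [← Complex.re_ofReal_mul]; push_cast; congr 1; ring
    rw [h5]
    have h6 : EE t * (1 - om ^ 2 / 2 * (t - m) ^ 2 - (1 / (2 * om * t) - c + d * t)) ≤ (-b * ff t).re := by
      refine le_trans ?_ h3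
      have := (EE_pos t).le
      gcongr
    refine le_trans (le_of_eq ?_) (mul_le_mul_of_nonneg_left h6 (by positivity))
    field_simp
    ring
  rw [integral_sub i123 i0, integral_sub i12 i3, integral_add i1 i2,
    integral_const_mul, integral_const_mul, integral_const_mul, integral_const_mul] at hle
  change (1 + c - om ^ 2 / 2 * m ^ 2) * MM (p + 1) + (om ^ 2 * m - d) * MM (p + 2)
    - om ^ 2 / 2 * MM (p + 3) - 1 / (2 * om) * MM p ≤ 0 at hle
  have hm2 : MM (p + 2) = m * MM (p + 1) := by rw [hm]; field_simp
  have key := mul_pos hpos hM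
  refine absurd hle (not_le.2 (lt_of_lt_of_eq key ?_))
  rw [hm2]
  field_simp
  ring

lemma nonvanish (n : ℕ) (hn : 0 < n) :
    (∫ t : ℝ in Set.Ioi 0, (t : ℂ) ^ (2 * n) * ff t) ≠ 0 := by
  have hInt := ker_int n hn
  obtain ⟨p, hp⟩ : ∃ p, 2 * n = p + 1 := ⟨2 * n - 1, by omega⟩
  have ho := om_pos
  have m0 := MM_pos p
  have m1 := MM_pos (p + 1)
  have m2 := MM_pos (p + 2)
  have r0 := MM_rec p
  have r1 := MM_rec (p + 1)
  have c0 := MM_cs p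
  have c1 := MM_cs (p + 1)
  push_cast at r1
  have e1 : ((p : ℝ) + 1) * (MM p / MM (p + 1)) = 2 * Real.pi * (MM (p + 2) / MM (p + 1)) + om := by
    field_simp; linarith
  have e2 : ((p : ℝ) + 1) + 1 = 2 * Real.pi * (MM (p + 3) / MM (p + 1)) + om * (MM (p + 2) / MM (p + 1)) := by
    field_simp; linarith
  have e3 : 1 ≤ MM p / MM (p + 1) * (MM (p + 2) / MM (p + 1)) := by
    rw [div_mul_div_comm, le_div_iff₀ (by positivity)]; linarith
  have e4 : (MM (p + 2) / MM (p + 1)) ^ 2 ≤ MM (p + 3) / MM (p + 1) := by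
    rw [div_pow, div_le_div_iff₀ (by positivity) m1]
    calc _ ≤ (MM (p + 1) * MM (p + 3)) * MM (p + 1) := by gcongr
      _ = _ := by ring
  have hr : ∀ t : ℝ, (Real.exp (-om * t)) ^ 2 = Real.exp (-(2 * om * t)) := by
    intro t; rw [← Real.exp_nat_mul]; congr 1; push_cast; ring
  rw [hp] at hInt ⊢
  rcases Nat.lt_or_ge 1 n with h | h
  · refine nonvanish_aux p 0 0 hInt (fun t ht => ?_) ?_
    · have := (rho_bd _ _ (by positivity) (hr t)).1
      linarith
    · have hp4 : (4 : ℝ) ≤ (p : ℝ) + 1 := by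
        have : 4 ≤ p + 1 := by omega
        exact_mod_cast this
      have := arith_big _ _ _ _ hp4 (by positivity) e1 e2 e3 e4
      linarith
  · have hp1 : p = 1 := by omega
    refine nonvanish_aux p (3 / 8) (om / 8) hInt (fun t ht => ?_) ?_
    · have := (rho_bd _ _ (by positivity) (hr t)).2
      linarith
    · have hp2 : (p : ℝ) + 1 = 2 := by rw [hp1]; norm_num
      rw [hp2] at e1 e2
      have := arith_two _ _ _ (by positivity) e1 e2 e3 e4
      linarith

/-- For every positive integer `n`, the point `−2n` is a simple zero of `R`:
`R(−2n) = 0` and `R′(−2n) ≠ 0`. -/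
theorem trivial_zeros_R_simple (n : ℕ) (hn : 0 < n) :
    RiemannR (-2 * n) = 0 ∧ deriv RiemannR (-2 * n) ≠ 0 := by
  have hn1 : (1 : ℝ) ≤ n := by exact_mod_cast hn
  have hre : (-2 * (n : ℂ)).re = -2 * n := by simp
  have hs : (-2 * (n : ℂ)).re < -1 := by rw [hre]; linarith
  have heq : Complex.exp ((3 * Real.pi * Complex.I / 4) * (-2 * n)) =
      Complex.exp (-(Real.pi * Complex.I / 4) * (-2 * n)) := by
    rw [Complex.exp_eq_exp_iff_exists_int]
    exact ⟨-n, by push_cast; ring⟩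
  have hmel : mellin ff (1 - (-2 * (n : ℂ))) ≠ 0 := by
    have := nonvanish n hn
    intro h
    apply this
    rw [← h]
    unfold mellin
    refine setIntegral_congr_fun measurableSet_Ioi fun t _ => ?_
    rw [smul_eq_mul, show (1 - (-2 * (n : ℂ)) - 1) = ((2 * n : ℕ) : ℂ) by push_cast; ring,
      Complex.cpow_natCast]
  refine ⟨by rw [R_eq _ hs, heq]; simp, ?_⟩
  have hev : RiemannR =ᶠ[nhds (-2 * (n : ℂ))] fun s => -ee *
    ((Complex.exp (-(Real.pi * Complex.I / 4) * s) - Complex.exp ((3 * Real.pi * Complex.I / 4) * s))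
      * mellin ff (1 - s)) := by
    have : {s : ℂ | s.re < -1} ∈ nhds (-2 * (n : ℂ)) :=
      (isOpen_lt Complex.continuous_re continuous_const).mem_nhds hs
    filter_upwards [this] with s hs
    exact R_eq s hs
  have hexp : ∀ k : ℂ, HasDerivAt (fun s : ℂ => Complex.exp (k * s))
      (Complex.exp (k * (-2 * n)) * (k * 1)) (-2 * (n : ℂ)) := fun k =>
    ((hasDerivAt_id (-2 * (n : ℂ))).const_mul k).cexp
  have hmd : DifferentiableAt ℂ (fun s => mellin ff (1 - s)) (-2 * (n : ℂ)) := by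
    refine DifferentiableAt.comp (g := mellin ff) (f := fun s : ℂ => 1 - s) _ (mellin_diff _ ?_) (by fun_prop)
    rw [Complex.sub_re, hre]; simp; linarith
  have hD := (((hexp (-(Real.pi * Complex.I / 4))).fun_sub (hexp (3 * Real.pi * Complex.I / 4))).fun_mul
    hmd.hasDerivAt).const_mul (-ee)
  rw [hev.deriv_eq, hD.deriv, heq, sub_self, zero_mul, add_zero]
  refine mul_ne_zero (neg_ne_zero.2 ee_ne) (mul_ne_zero ?_ hmel)
  rw [← mul_sub]
  refine mul_ne_zero (Complex.exp_ne_zero _) ?_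
  rw [show (-(Real.pi * Complex.I / 4) * 1 - 3 * Real.pi * Complex.I / 4 * 1 : ℂ) = -(Real.pi * Complex.I) by ring]
  simp [Real.pi_ne_zero]
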